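/- arXiv:2108.13659 — 3 statements merged into one kernel-verified Lean document; each statement's English description precedes it below -/
import Mathlib

section
/- For every odd integer k ≥ 1 and every n ≥ k+1, there exists a σ_k-Gray cycle over the set of all 2^n binary words of length n. -/
/-- A sigma_k-Gray cycle over the set of *all* words of length `n` over a `p`-letter
alphabet: a cyclic enumeration `w` of all `p ^ n` words, each exactly once, with
consecutive words (cyclically) at Hamming distance exactly `k`. -/
def GrayCycleAll (p n k : ℕ) (w : ZMod (p ^ n) → (Fin n → Fin p)) : Prop :=
  Function.Bijective w ∧ ∀ i, hammingDist (w i) (w (i + 1)) = k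

/-- The reflected Gray path, with steps along standard basis vectors. -/
theorem gray_path (n : ℕ) : ∃ f : ℕ → (Fin n → ZMod 2),
    (∀ a b, a < 2 ^ n → b < 2 ^ n → f a = f b → a = b) ∧
    (∀ i, i + 1 < 2 ^ n → ∃ j, f (i + 1) - f i = Pi.single j 1) ∧
    (0 < n → ∃ j, f 0 - f (2 ^ n - 1) = Pi.single j 1) := by
  induction n with
  | zero =>
    refine ⟨fun _ => 0, ?_, ?_, ?_⟩
    · intro a b ha hb _
      simp at ha hb
      omega
    · intro i hi
      simp at hi
    · intro h
      omega
  | succ n ih =>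
    obtain ⟨f, hinj, hstep, -⟩ := ih
    have hpos : 0 < 2 ^ n := by positivity
    have hp : 2 ^ (n + 1) = 2 ^ n + 2 ^ n := by ring
    refine ⟨fun i => if i < 2 ^ n then Fin.cons 0 (f i)
      else Fin.cons 1 (f (2 ^ (n + 1) - 1 - i)), ?_, ?_, ?_⟩
    · intro a b ha hb hab
      dsimp only at hab
      split_ifs at hab with h1 h2 h2
      · exact hinj a b h1 h2 (Fin.cons_right_injective (α := fun _ => ZMod 2) _ hab)
      · have := congrFun hab 0
        simp at this
      · have := congrFun hab 0
        simp at this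
      · have := hinj _ _ (by omega) (by omega)
          (Fin.cons_right_injective (α := fun _ => ZMod 2) _ hab)
        omega
    · intro i hi
      dsimp only
      by_cases h1 : i + 1 < 2 ^ n
      · have h2 : i < 2 ^ n := by omega
        obtain ⟨j, hj⟩ := hstep i h1
        refine ⟨j.succ, ?_⟩
        rw [if_pos h1, if_pos h2]
        ext m
        refine Fin.cases ?_ (fun m => ?_) m
        · simp
        · have := congrFun hj m
          simpa [Pi.single_apply] using this
      · by_cases h2 : i < 2 ^ n
        · refine ⟨0, ?_⟩
          rw [if_neg h1, if_pos h2]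
          have : 2 ^ (n + 1) - 1 - (i + 1) = i := by omega
          rw [this]
          ext m
          refine Fin.cases ?_ (fun m => ?_) m
          · simp
          · simp
        · obtain ⟨j, hj⟩ := hstep (2 ^ (n + 1) - 1 - (i + 1)) (by omega)
          have e : 2 ^ (n + 1) - 1 - (i + 1) + 1 = 2 ^ (n + 1) - 1 - i := by omega
          rw [e] at hj
          refine ⟨j.succ, ?_⟩
          rw [if_neg h1, if_neg h2]
          ext m
          refine Fin.cases ?_ (fun m => ?_) m
          · simp
          · have := congrFun hj m
            simp only [Pi.sub_apply] at this
            simp only [Pi.sub_apply, Fin.cons_succ]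
            rw [← neg_sub, this, ZMod.neg_eq_self_mod_two]
            simp [Pi.single_apply]
    · intro _
      refine ⟨0, ?_⟩
      dsimp only
      rw [if_pos hpos, if_neg (by omega)]
      have : 2 ^ (n + 1) - 1 - (2 ^ (n + 1) - 1) = 0 := by omega
      rw [this]
      ext m
      refine Fin.cases ?_ (fun m => ?_) m
      · simp
      · simp

/-- Indicator vector of a finset. -/
def indVec {n : ℕ} (S : Finset (Fin n)) : Fin n → ZMod 2 := ∑ i ∈ S, Pi.single i 1

theorem hammingNorm_indVec {n : ℕ} (S : Finset (Fin n)) : hammingNorm (indVec S) = S.card := by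
  unfold hammingNorm indVec
  congr 1
  ext m
  simp [Finset.sum_apply, Pi.single_apply]

theorem span_weight (k n : ℕ) (hk : Odd k) (hn : k + 1 ≤ n) :
    Submodule.span (ZMod 2) {v : Fin n → ZMod 2 | hammingNorm v = k} = ⊤ := by
  set W := Submodule.span (ZMod 2) {v : Fin n → ZMod 2 | hammingNorm v = k} with hW
  have hmem : ∀ S : Finset (Fin n), S.card = k → indVec S ∈ W := fun S hS =>
    Submodule.subset_span (by simp [hammingNorm_indVec, hS])
  have hk1 : 1 ≤ k := hk.pos
  have hdiff : ∀ i j : Fin n, (Pi.single i 1 - Pi.single j 1 : Fin n → ZMod 2) ∈ W := by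
    intro i j
    by_cases hij : i = j
    · subst hij
      simp
    have hc : k - 1 ≤ ((Finset.univ.erase i).erase j).card := by
      rw [Finset.card_erase_of_mem (by simp [Ne.symm hij]), Finset.card_erase_of_mem (by simp)]
      simp
      omega
    obtain ⟨S, hS, hcard⟩ := Finset.exists_subset_card_eq hc
    have hi : i ∉ S := fun h => by simpa using hS h
    have hj : j ∉ S := fun h => by simpa using hS h
    have h1 := hmem (insert i S) (by rw [Finset.card_insert_of_notMem hi]; omega)
    have h2 := hmem (insert j S) (by rw [Finset.card_insert_of_notMem hj]; omega)
    have := W.sub_mem h1 h2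
    simpa [indVec, Finset.sum_insert hi, Finset.sum_insert hj] using this
  have hsingle : ∀ i : Fin n, (Pi.single i 1 : Fin n → ZMod 2) ∈ W := by
    intro i
    obtain ⟨S, -, hcard⟩ := Finset.exists_subset_card_eq
      (s := (Finset.univ : Finset (Fin n))) (n := k) (by simp; omega)
    have h1 : ∑ j ∈ S, (Pi.single i 1 - Pi.single j 1 : Fin n → ZMod 2) ∈ W :=
      W.sum_mem fun j _ => hdiff i j
    have h2 := W.add_mem h1 (hmem S hcard)
    rw [Finset.sum_sub_distrib, indVec, sub_add_cancel, Finset.sum_const, hcard] at h2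
    have h3 : k • (Pi.single i 1 : Fin n → ZMod 2) = Pi.single i 1 := by
      rw [← Nat.cast_smul_eq_nsmul (ZMod 2), ZMod.natCast_eq_one_iff_odd.2 hk, one_smul]
    rwa [h3] at h2
  rw [eq_top_iff]
  intro v _
  rw [pi_eq_sum_univ' v]
  exact W.sum_mem fun i _ => W.smul_mem _ (by
    convert hsingle i using 1)

theorem exists_equiv (k n : ℕ) (hk : Odd k) (hn : k + 1 ≤ n) :
    ∃ L : (Fin n → ZMod 2) ≃ₗ[ZMod 2] (Fin n → ZMod 2),
      ∀ j, hammingNorm (L (Pi.single j 1)) = k := by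
  let b := Module.Basis.ofSpan (span_weight k n hk hn).ge
  have hb : ∀ x, hammingNorm (b x) = k := fun x =>
    Module.Basis.ofSpan_subset (span_weight k n hk hn).ge ⟨x, rfl⟩
  have := Module.Basis.fintypeIndexOfRankLtAleph0 b (Module.rank_lt_aleph0 _ _)
  have hc := Module.finrank_eq_card_basis b
  rw [Module.finrank_fin_fun] at hc
  let e := Fintype.equivFinOfCardEq hc.symm
  let c := b.reindex e
  refine ⟨c.equivFun.symm, fun j => ?_⟩
  have : c.equivFun.symm (Pi.single j 1) = c j := by
    rw [LinearEquiv.symm_apply_eq]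
    ext m
    simp [Finsupp.single_apply, Pi.single_apply, eq_comm]
  rw [this, Module.Basis.reindex_apply]
  exact hb _

/-- Proposition 2: for every odd `k ≥ 1` and `n ≥ k + 1` there exists a sigma_k-Gray
cycle over the set of all `2 ^ n` binary words of length `n`. -/
theorem stmt12 (k n : ℕ) (hk : Odd k) (hn : k + 1 ≤ n) :
    ∃ w : ZMod (2 ^ n) → (Fin n → Fin 2), GrayCycleAll 2 n k w := by
  obtain ⟨L, hL⟩ := exists_equiv k n hk hn
  obtain ⟨f, hinj, hstep, hclose⟩ := gray_path n
  have key : ∃ w : ZMod (2 ^ n) → (Fin n → ZMod 2), Function.Bijective w ∧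
      ∀ i, hammingDist (w i) (w (i + 1)) = k := by
    refine ⟨fun i => L (f i.val), ?_, ?_⟩
    · rw [Fintype.bijective_iff_injective_and_card]
      refine ⟨fun a b hab => ?_, by simp [ZMod.card]⟩
      exact ZMod.val_injective _ (hinj _ _ (ZMod.val_lt a) (ZMod.val_lt b) (L.injective hab))
    · intro i
      have hs : ∃ j, f (i + 1).val - f i.val = Pi.single j 1 := by
        have hlt := ZMod.val_lt i
        by_cases h : i.val + 1 < 2 ^ n
        · have h1 : (i + 1).val = i.val + 1 := by
            have : ((i.val + 1 : ℕ) : ZMod (2 ^ n)) = i + 1 := by simp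
            rw [← this, ZMod.val_natCast, Nat.mod_eq_of_lt h]
          rw [h1]
          exact hstep _ h
        · have h1 : i.val = 2 ^ n - 1 := by omega
          have h2 : i + 1 = 0 := by
            have : ((i.val + 1 : ℕ) : ZMod (2 ^ n)) = 0 := by
              rw [show i.val + 1 = 2 ^ n by omega, ZMod.natCast_self]
            simpa using this
          rw [h2, h1, ZMod.val_zero]
          exact hclose (by omega)
      obtain ⟨j, hj⟩ := hs
      rw [hammingDist_eq_hammingNorm]
      show hammingNorm (-L (f i.val) + L (f (i + 1).val)) = k
      rw [neg_add_eq_sub, ← map_sub, hj]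
      exact hL j
  exact key
end

section
/- Let k ≥ 2 be even and n ≥ k+1. If there exists a σ_{k-1}-Gray cycle over the set of all binary words of length n-1, then there exists a σ_k-Gray cycle over Even_1^n, the set of binary words of length n of even weight, and there exists a σ_k-Gray cycle over Odd_1^n, the set of binary words of length n of odd weight. -/
/-- A sigma_k-Gray cycle over a finite set `X` of words of length `n` over a `p`-letter
alphabet: a sequence of `X.card` words enumerating each element of `X` exactly once,
with consecutive words (cyclically) at Hamming distance exactly `k`. -/
def GrayCycleOn (p n k : ℕ) (X : Finset (Fin n → Fin p))
    (w : ZMod X.card → (Fin n → Fin p)) : Prop :=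
  Function.Injective w ∧ (∀ x, x ∈ X ↔ ∃ i, w i = x) ∧
  ∀ i, hammingDist (w i) (w (i + 1)) = k

/-- The weight of a binary word: the number of positions carrying letter `1`. -/
def wt {n : ℕ} (x : Fin n → Fin 2) : ℕ := (Finset.univ.filter fun i => x i = 1).card

theorem wt_cons {m : ℕ} (a : Fin 2) (x : Fin m → Fin 2) :
    wt (Fin.cons a x : Fin (m + 1) → Fin 2) = (if a = 1 then 1 else 0) + wt x := by
  simp only [wt, Finset.card_filter, Fin.sum_univ_succ, Fin.cons_zero, Fin.cons_succ]

theorem hamming_cons {m : ℕ} (a b : Fin 2) (x y : Fin m → Fin 2) :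
    hammingDist (Fin.cons a x : Fin (m + 1) → Fin 2) (Fin.cons b y)
      = (if a ≠ b then 1 else 0) + hammingDist x y := by
  simp only [hammingDist, Finset.card_filter, Fin.sum_univ_succ, Fin.cons_zero, Fin.cons_succ]

theorem hamming_parity {m : ℕ} (x y : Fin m → Fin 2) :
    Even (hammingDist x y + wt x + wt y) := by
  simp only [hammingDist, wt, Finset.card_filter, ← Finset.sum_add_distrib]
  apply Finset.even_sum
  intro i _
  generalize x i = a
  generalize y i = b
  revert a b
  decide

/-- Extend a word by one letter so that the weight has residue `r` modulo 2. -/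
def extW {m : ℕ} (r : ℕ) (x : Fin m → Fin 2) : Fin (m + 1) → Fin 2 :=
  Fin.cons (if wt x % 2 = r then 0 else 1) x

theorem extW_inj {m : ℕ} (r : ℕ) : Function.Injective (extW (m := m) r) := by
  intro x y h
  exact (Fin.cons_injective2 h).2

theorem extW_wt {m : ℕ} (r : ℕ) (hr : r < 2) (x : Fin m → Fin 2) : wt (extW r x) % 2 = r := by
  unfold extW
  rw [wt_cons]
  by_cases h : wt x % 2 = r
  · simp [h]
  · simp [h]
    omega

theorem extW_surj {m : ℕ} (r : ℕ) (z : Fin (m + 1) → Fin 2)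
    (hz : wt z % 2 = r) : extW r (Fin.tail z) = z := by
  have h0 : (Fin.cons (z 0) (Fin.tail z) : Fin (m + 1) → Fin 2) = z := Fin.cons_self_tail z
  have h1 := wt_cons (z 0) (Fin.tail z)
  rw [h0] at h1
  have : (if wt (Fin.tail z) % 2 = r then 0 else 1) = z 0 := by
    generalize z 0 = a at h1
    fin_cases a
    · simp at h1
      simp [← h1, hz]
    · simp at h1
      have : wt (Fin.tail z) % 2 ≠ r := by omega
      simp [this]
  unfold extW
  rw [this, h0]

theorem gray_step (k m r : ℕ) (hr : r < 2) (hk : 2 ≤ k) (hke : Even k)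
    (X : Finset (Fin (m + 1) → Fin 2)) (hX : ∀ x, x ∈ X ↔ wt x % 2 = r)
    (w : ZMod (2 ^ m) → (Fin m → Fin 2)) (h : GrayCycleAll 2 m (k - 1) w) :
    ∃ w : ZMod X.card → (Fin (m + 1) → Fin 2), GrayCycleOn 2 (m + 1) k X w := by
  have hc : X.card = 2 ^ m := by
    have : X = Finset.univ.image (extW (m := m) r) := by
      ext z
      simp only [hX, Finset.mem_image, Finset.mem_univ, true_and]
      exact ⟨fun hz => ⟨_, extW_surj r z hz⟩, fun ⟨x, hx⟩ => hx ▸ extW_wt r hr x⟩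
    rw [this, Finset.card_image_of_injective _ (extW_inj r)]
    simp
  obtain ⟨hb, hd⟩ := h
  unfold GrayCycleOn
  rw [hc]
  refine ⟨fun i => extW r (w i), (extW_inj r).comp hb.1, ?_, ?_⟩
  · intro z
    rw [hX]
    constructor
    · intro hz
      obtain ⟨i, hi⟩ := hb.2 (Fin.tail z)
      exact ⟨i, by simp only [hi, extW_surj r z hz]⟩
    · rintro ⟨i, rfl⟩
      exact extW_wt r hr _
  · intro i
    have hp := hamming_parity (w i) (w (i + 1))
    have hdi := hd i
    simp only [extW, hamming_cons]
    rw [hdi] at hp ⊢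
    rw [Nat.even_iff] at hp hke
    by_cases h1 : wt (w i) % 2 = r <;> by_cases h2 : wt (w (i + 1)) % 2 = r <;>
      simp [h1, h2] <;> omega

/-- Induction step for even `k`: a sigma_{k-1}-Gray cycle over all binary words of
length `n - 1` yields sigma_k-Gray cycles over the even-weight binary words of
length `n` and over the odd-weight ones. -/
theorem stmt13 (k n : ℕ) (hk : 2 ≤ k) (hke : Even k) (hn : k + 1 ≤ n)
    (h : ∃ w : ZMod (2 ^ (n - 1)) → (Fin (n - 1) → Fin 2),
      GrayCycleAll 2 (n - 1) (k - 1) w) :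
    (∃ w : ZMod (Finset.univ.filter fun x : Fin n → Fin 2 => Even (wt x)).card →
        (Fin n → Fin 2),
      GrayCycleOn 2 n k (Finset.univ.filter fun x => Even (wt x)) w) ∧
    (∃ w : ZMod (Finset.univ.filter fun x : Fin n → Fin 2 => Odd (wt x)).card →
        (Fin n → Fin 2),
      GrayCycleOn 2 n k (Finset.univ.filter fun x => Odd (wt x)) w) := by
  obtain ⟨w, hw⟩ := h
  obtain ⟨m, rfl⟩ : ∃ m, n = m + 1 := ⟨n - 1, by omega⟩
  constructor
  · exact gray_step k m 0 (by norm_num) hk hke _ (by simp [Nat.even_iff]) w hw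
  · exact gray_step k m 1 (by norm_num) hk hke _ (by simp [Nat.odd_iff]) w hw
end

section
/- Let k ≥ 2 be even and n ≥ k+1. The maximum cardinality of a finite set X of binary words of length at most n such that some σ_k-Gray cycle over X exists equals 2^{n-1}; that is, λ_{A,σ_k}(n) = 2^{n-1} for the binary alphabet A and even k. -/
/-- The k-character substitution: `u` and `v` have the same length and differ in
exactly `k` positions. -/
def sigmaRel {A : Type*} [DecidableEq A] (k : ℕ) (u v : List A) : Prop :=
  u.length = v.length ∧ ((u.zip v).filter fun q => decide (q.1 ≠ q.2)).length = k

/-- A sigma_k-Gray cycle over a finite set `X` of words (lists): a sequence of `X.card`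
words enumerating each element of `X` exactly once such that consecutive words
(cyclically, including the wrap-around pair) are related by `sigmaRel k`. -/
def GrayCycleList {A : Type*} [DecidableEq A] (k : ℕ) (X : Finset (List A))
    (w : ZMod X.card → List A) : Prop :=
  Function.Injective w ∧ (∀ x, x ∈ X ↔ ∃ i, w i = x) ∧
  ∀ i, sigmaRel k (w i) (w (i + 1))

/-- Flip the first `j` letters. -/
def fl : ℕ → List (Fin 2) → List (Fin 2)
  | 0, w => w
  | _ + 1, [] => []
  | j + 1, a :: w => (a + 1) :: fl j w

/-- Parity of a word. -/
def par : List (Fin 2) → Fin 2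
  | [] => 0
  | a :: w => a + par w

theorem fin2_cases (a b : Fin 2) : a = b ∨ (a ≠ b ∧ a = b + 1 ∧ b = a + 1) := by
  revert a b; decide

theorem sig_nil (k : ℕ) : sigmaRel k ([] : List (Fin 2)) [] ↔ k = 0 := by
  simp [sigmaRel, eq_comm]

theorem sig_same (k : ℕ) (a : Fin 2) (u v : List (Fin 2)) :
    sigmaRel k (a :: u) (a :: v) ↔ sigmaRel k u v := by
  simp [sigmaRel]

theorem sig_diff (k : ℕ) (a b : Fin 2) (h : a ≠ b) (u v : List (Fin 2)) :
    sigmaRel k (a :: u) (b :: v) ↔ ∃ j, k = j + 1 ∧ sigmaRel j u v := by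
  simp only [sigmaRel, List.length_cons, List.zip_cons_cons]
  rw [List.filter_cons_of_pos (by simpa using h)]
  simp only [List.length_cons]
  constructor
  · rintro ⟨h1, h2⟩
    exact ⟨_, h2.symm, by omega, rfl⟩
  · rintro ⟨j, h1, h2, h3⟩
    exact ⟨by omega, by omega⟩

theorem fl_len (j : ℕ) (w : List (Fin 2)) : (fl j w).length = w.length := by
  induction j generalizing w with
  | zero => rfl
  | succ j ih => cases w with
    | nil => rfl
    | cons a w => simp [fl, ih]

theorem fl_fl (j : ℕ) (w : List (Fin 2)) : fl j (fl j w) = w := by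
  induction j generalizing w with
  | zero => rfl
  | succ j ih => cases w with
    | nil => rfl
    | cons a w =>
      simp only [fl, ih]
      congr 1
      revert a; decide

theorem fl_inj (j : ℕ) : Function.Injective (fl j) :=
  Function.LeftInverse.injective (fl_fl j)

theorem sig_self (w : List (Fin 2)) : sigmaRel 0 w w := by
  induction w with
  | nil => simp [sig_nil]
  | cons a w ih => rwa [sig_same]

theorem sig_fl (j : ℕ) (w : List (Fin 2)) (h : j ≤ w.length) : sigmaRel j w (fl j w) := by
  induction j generalizing w with
  | zero => exact sig_self w
  | succ j ih => cases w with
    | nil => simp at h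
    | cons a w =>
      rw [fl, sig_diff _ _ _ (by clear h; revert a; decide)]
      exact ⟨j, rfl, ih w (by simpa using h)⟩

theorem sig_symm (k : ℕ) (u v : List (Fin 2)) (h : sigmaRel k u v) : sigmaRel k v u := by
  induction u generalizing k v with
  | nil => cases v with
    | nil => exact h
    | cons b v => simp [sigmaRel] at h
  | cons a u ih => cases v with
    | nil => simp [sigmaRel] at h
    | cons b v =>
      rcases eq_or_ne a b with rfl | hab
      · rw [sig_same] at *; exact ih _ _ h
      · rw [sig_diff _ _ _ hab] at h
        rw [sig_diff _ _ _ hab.symm]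
        obtain ⟨j, h1, h2⟩ := h
        exact ⟨j, h1, ih _ _ h2⟩

theorem sig_fl_fl (k j : ℕ) (u v : List (Fin 2)) (h : sigmaRel k u v) :
    sigmaRel k (fl j u) (fl j v) := by
  induction u generalizing k v j with
  | nil => cases v with
    | nil => cases j <;> exact h
    | cons b v => simp [sigmaRel] at h
  | cons a u ih => cases v with
    | nil => simp [sigmaRel] at h
    | cons b v =>
      cases j with
      | zero => exact h
      | succ j =>
        rcases eq_or_ne a b with rfl | hab
        · simp only [fl]
          rw [sig_same] at *; exact ih _ _ _ h
        · rw [sig_diff _ _ _ hab] at h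
          simp only [fl]
          rw [sig_diff _ _ _ (by simpa using hab)]
          obtain ⟨i, h1, h2⟩ := h
          exact ⟨i, h1, ih _ _ _ h2⟩

theorem sig_compl (k j : ℕ) (u v : List (Fin 2)) (h : sigmaRel k u v)
    (hl : u.length = k + j) : sigmaRel j u (fl (k + j) v) := by
  induction u generalizing k v j with
  | nil => cases v with
    | nil =>
      obtain rfl : k = 0 := by simp at hl; omega
      obtain rfl : j = 0 := by simp at hl; omega
      exact h
    | cons b v => simp [sigmaRel] at h
  | cons a u ih => cases v with
    | nil => simp [sigmaRel] at h
    | cons b v =>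
      simp only [List.length_cons] at hl
      rcases eq_or_ne a b with rfl | hab
      · rw [sig_same] at h
        cases j with
        | zero =>
          exfalso
          have := h.2
          have h2 := List.length_filter_le (fun q : Fin 2 × Fin 2 => decide (q.1 ≠ q.2)) (u.zip v)
          rw [List.length_zip] at h2
          omega
        | succ j =>
          rw [← add_assoc, fl, sig_diff _ _ _ (by revert a; decide)]
          exact ⟨j, rfl, ih k j v h (by omega)⟩
      · rw [sig_diff _ _ _ hab] at h
        obtain ⟨i, rfl, h2⟩ := h
        have : b + 1 = a := by revert a b; decide
        rw [show i + 1 + j = (i + j) + 1 by omega, fl, this, sig_same]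
        exact ih i j v h2 (by omega)

open scoped Fin.CommRing in
theorem sig_par (k : ℕ) (u v : List (Fin 2)) (h : sigmaRel k u v) :
    par v = par u + (k : Fin 2) := by
  induction u generalizing k v with
  | nil => cases v with
    | nil => rw [sig_nil] at h; subst h; rfl
    | cons b v => simp [sigmaRel] at h
  | cons a u ih => cases v with
    | nil => simp [sigmaRel] at h
    | cons b v =>
      rcases eq_or_ne a b with rfl | hab
      · rw [sig_same] at h
        simp only [par, ih _ _ h, add_assoc]
      · rw [sig_diff _ _ _ hab] at h
        obtain ⟨i, rfl, h2⟩ := h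
        have : b = a + 1 := by revert a b; decide
        simp only [par, ih _ _ h2, this]
        push_cast
        generalize (i : Fin 2) = c
        generalize par u = d
        clear this hab
        revert a c d; decide

/-- Closed Gray lists. -/
def GLst (k n : ℕ) (L : List (List (Fin 2))) : Prop :=
  L.Nodup ∧ (∀ w ∈ L, w.length = n) ∧ L.IsChain (sigmaRel k)

def Closed (k : ℕ) (L : List (List (Fin 2))) : Prop :=
  ∀ x ∈ L.getLast?, ∀ y ∈ L.head?, sigmaRel k x y

def nxt (j : ℕ) (L : List (List (Fin 2))) : List (List (Fin 2)) :=
  L.map (fun w => 0 :: w) ++ L.reverse.map (fun w => 1 :: fl j w)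

theorem nxt_len (j : ℕ) (L : List (List (Fin 2))) : (nxt j L).length = 2 * L.length := by
  simp [nxt]; omega

theorem nxt_GL (j n : ℕ) (hj : j ≤ n) (L : List (List (Fin 2))) (h : GLst (j + 1) n L) :
    GLst (j + 1) (n + 1) (nxt j L) := by
  obtain ⟨h1, h2, h3⟩ := h
  refine ⟨?_, ?_, ?_⟩
  · rw [nxt, List.nodup_append]
    refine ⟨h1.map (by intro a b; simp), (List.nodup_reverse.2 h1).map ?_, ?_⟩
    · intro a b hab
      simp only [List.cons.injEq, true_and] at hab
      exact fl_inj j hab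
    · intro a ha b hb
      simp only [List.mem_map] at ha hb
      obtain ⟨a, _, rfl⟩ := ha
      obtain ⟨b, _, rfl⟩ := hb
      simp
  · intro w hw
    simp only [nxt, List.mem_append, List.mem_map, List.mem_reverse] at hw
    rcases hw with ⟨a, ha, rfl⟩ | ⟨a, ha, rfl⟩
    · simp [h2 a ha]
    · simp [fl_len, h2 a ha]
  · rw [nxt, List.isChain_append]
    refine ⟨?_, ?_, ?_⟩
    · rw [List.isChain_map]
      exact h3.imp fun a b hab => (sig_same _ _ _ _).2 hab
    · rw [List.isChain_map, List.isChain_reverse]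
      exact h3.imp fun a b hab => (sig_same _ _ _ _).2 (sig_fl_fl _ _ _ _ (sig_symm _ _ _ hab))
    · intro x hx y hy
      simp only [List.getLast?_map, List.head?_map, List.head?_reverse, Option.mem_def,
        Option.map_eq_some_iff] at hx hy
      obtain ⟨a, ha, rfl⟩ := hx
      obtain ⟨b, hb, rfl⟩ := hy
      rw [ha] at hb
      cases hb
      rw [sig_diff _ _ _ (by decide)]
      exact ⟨j, rfl, sig_fl _ _ (by rw [h2 a (List.mem_of_getLast? ha)]; exact hj)⟩

theorem nxt_closed (j n : ℕ) (hj : j ≤ n) (L : List (List (Fin 2))) (h : GLst (j + 1) n L) :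
    Closed (j + 1) (nxt j L) := by
  obtain ⟨h1, h2, h3⟩ := h
  cases L with
  | nil => simp [Closed, nxt]
  | cons a L =>
    intro x hx y hy
    have hx' : 1 :: fl j a = x := by
      rw [nxt, List.reverse_cons, List.map_append, ← List.append_assoc,
        List.map_singleton, List.getLast?_concat] at hx
      simpa using hx
    have hy' : 0 :: a = y := by simpa [nxt] using hy
    subst hx' hy'
    apply sig_symm
    rw [sig_diff _ _ _ (by decide)]
    exact ⟨j, rfl, sig_fl _ _ (by rw [h2 a (by simp)]; exact hj)⟩

theorem gray1 (n : ℕ) : ∃ L, GLst 1 n L ∧ L.length = 2 ^ n := by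
  induction n with
  | zero => exact ⟨[[]], by simp [GLst], rfl⟩
  | succ n ih =>
    obtain ⟨L, h1, h2⟩ := ih
    exact ⟨nxt 0 L, nxt_GL 0 n (by omega) L h1, by rw [nxt_len, h2]; ring⟩

theorem gray1c (n : ℕ) : ∃ L, GLst 1 (n + 1) L ∧ L.length = 2 ^ (n + 1) ∧ Closed 1 L := by
  obtain ⟨L, h1, h2⟩ := gray1 n
  exact ⟨nxt 0 L, nxt_GL 0 n (by omega) L h1, by rw [nxt_len, h2]; ring,
    nxt_closed 0 n (by omega) L h1⟩

def phi (k : ℕ) (g : List (Fin 2)) : List (Fin 2) :=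
  par g :: (if par g = 0 then g else fl k g)

theorem phi_inj (k : ℕ) : Function.Injective (phi k) := by
  intro a b h
  simp only [phi, List.cons.injEq] at h
  obtain ⟨h1, h2⟩ := h
  rw [h1] at h2
  split_ifs at h2
  · exact h2
  · exact fl_inj k h2

open scoped Fin.CommRing in
theorem phi_sig (j : ℕ) (u v : List (Fin 2)) (hu : u.length = j + 1) (h : sigmaRel 1 u v) :
    sigmaRel (j + 1) (phi (j + 1) u) (phi (j + 1) v) := by
  have hp := sig_par _ _ _ h
  have hv : v.length = j + 1 := by rw [← h.1, hu]
  have hne : par u ≠ par v := by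
    rw [hp]; generalize par u = d; revert d; decide
  rw [phi, phi, sig_diff _ _ _ hne]
  refine ⟨j, rfl, ?_⟩
  split_ifs with h1 h2 h2
  · exact absurd (h1.trans h2.symm) hne
  · rw [add_comm j 1]; exact sig_compl 1 j u v h (by omega)
  · apply sig_symm
    rw [add_comm j 1]; exact sig_compl 1 j v u (sig_symm _ _ _ h) (by omega)
  · exfalso
    revert h1 h2 hne
    generalize par u = a
    generalize par v = b
    revert a b; decide

theorem base (j : ℕ) : ∃ L, GLst (j + 1) (j + 2) L ∧ L.length = 2 ^ (j + 1) ∧ Closed (j + 1) L := by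
  obtain ⟨L, ⟨h1, h2, h3⟩, h4, h5⟩ := gray1c j
  refine ⟨L.map (phi (j + 1)), ⟨h1.map (phi_inj _), ?_, ?_⟩, by simpa using h4, ?_⟩
  · intro w hw
    obtain ⟨a, ha, rfl⟩ := List.mem_map.1 hw
    have := h2 a ha
    simp only [phi, List.length_cons]
    split_ifs <;> simp [fl_len, this]
  · rw [List.isChain_map]
    have h3' := h3
    rw [List.isChain_iff_getElem] at h3' ⊢
    intro i hi
    exact phi_sig j _ _ (h2 _ (List.getElem_mem _)) (h3' i hi)
  · intro x hx y hy
    simp only [List.getLast?_map, List.head?_map, Option.mem_def, Option.map_eq_some_iff] at hx hy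
    obtain ⟨a, ha, rfl⟩ := hx
    obtain ⟨b, hb, rfl⟩ := hy
    exact phi_sig j _ _ (h2 _ (List.mem_of_getLast? ha)) (h5 a ha b hb)

theorem grayk (j m : ℕ) : ∃ L, GLst (j + 1) (j + 2 + m) L ∧ L.length = 2 ^ (j + 1 + m) ∧
    Closed (j + 1) L := by
  induction m with
  | zero => exact base j
  | succ m ih =>
    obtain ⟨L, h1, h2, h3⟩ := ih
    have hj : j ≤ j + 2 + m := by omega
    exact ⟨nxt j L, nxt_GL j _ (by omega) L h1, by rw [nxt_len, h2]; ring,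
      nxt_closed j (j + 2 + m) hj L h1⟩

theorem exists_cycle (k n : ℕ) (L : List (List (Fin 2))) (h : GLst k n L) (hL : L ≠ [])
    (hc : Closed k L) : ∃ w : ZMod L.toFinset.card → List (Fin 2),
      GrayCycleList k L.toFinset w := by
  obtain ⟨h1, h2, h3⟩ := h
  have hcard : L.toFinset.card = L.length := List.toFinset_card_of_nodup h1
  have hpos : 0 < L.length := List.length_pos_iff.2 hL
  have hx : ∀ x, x ∈ L.toFinset ↔ x ∈ L := fun x => List.mem_toFinset
  generalize L.toFinset = X at *
  unfold GrayCycleList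
  generalize X.card = N at *
  subst hcard
  have : NeZero L.length := ⟨hpos.ne'⟩
  refine ⟨fun i => L[i.val]'(ZMod.val_lt i), ?_, ?_, ?_⟩
  · intro a b hab
    exact ZMod.val_injective _ ((h1.getElem_inj_iff).1 hab)
  · intro x
    rw [hx, List.mem_iff_getElem]
    constructor
    · rintro ⟨i, hi, rfl⟩
      exact ⟨(i : ZMod L.length), by simp [ZMod.val_cast_of_lt hi]⟩
    · rintro ⟨i, rfl⟩
      exact ⟨i.val, ZMod.val_lt i, rfl⟩
  · intro i
    have hi := ZMod.val_lt i
    by_cases hl : i.val + 1 < L.length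
    · have : (i + 1).val = i.val + 1 := by
        rw [ZMod.val_add, ZMod.val_one_eq_one_mod, Nat.add_mod_mod, Nat.mod_eq_of_lt hl]
      simp only [this]
      exact (List.isChain_iff_getElem.1 h3) i.val hl
    · have h0 : i.val + 1 = L.length := by omega
      have : (i + 1).val = 0 := by
        rw [ZMod.val_add, ZMod.val_one_eq_one_mod, Nat.add_mod_mod, h0, Nat.mod_self]
      simp only [this]
      apply hc
      · rw [List.getLast?_eq_getElem?, Option.mem_def, List.getElem?_eq_some_iff]
        refine ⟨by omega, ?_⟩
        congr 1
        omega
      · rw [List.head?_eq_getElem?, Option.mem_def, List.getElem?_eq_some_iff]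
        exact ⟨hpos, rfl⟩

open scoped Fin.CommRing in
theorem upper (k n : ℕ) (hke : Even k) (X : Finset (List (Fin 2))) (hX : ∀ x ∈ X, x.length ≤ n)
    (w : ZMod X.card → List (Fin 2)) (hw : GrayCycleList k X w) : X.card ≤ 2 ^ (n - 1) := by
  obtain ⟨h1, h2, h3⟩ := hw
  rcases Nat.eq_zero_or_pos X.card with h0 | hpos
  · rw [h0]; exact Nat.zero_le _
  have : NeZero X.card := ⟨hpos.ne'⟩
  have hk0 : (k : Fin 2) = 0 := by
    obtain ⟨r, rfl⟩ := hke
    push_cast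
    generalize (r : Fin 2) = c
    revert c; decide
  have key : ∀ m : ℕ, (w m).length = (w 0).length ∧ par (w m) = par (w 0) := by
    intro m
    induction m with
    | zero => simp
    | succ m ih =>
      have := h3 (m : ZMod X.card)
      have hp := sig_par _ _ _ this
      rw [hk0, add_zero] at hp
      push_cast
      exact ⟨this.1.symm.trans ih.1, hp.trans ih.2⟩
  have key2 : ∀ x ∈ X, x.length = (w 0).length ∧ par x = par (w 0) := by
    intro x hx
    obtain ⟨i, rfl⟩ := (h2 x).1 hx
    have := key i.val
    rwa [ZMod.natCast_zmod_val] at this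
  have hle : (w 0).length ≤ n := hX _ ((h2 _).2 ⟨0, rfl⟩)
  let f : X → List.Vector (Fin 2) ((w 0).length - 1) := fun x =>
    ⟨x.1.tail, by rw [List.length_tail, (key2 x.1 x.2).1]⟩
  have hf : Function.Injective f := by
    rintro ⟨a, ha⟩ ⟨b, hb⟩ hab
    have ht : a.tail = b.tail := congrArg Subtype.val hab
    have ha' := key2 a ha
    have hb' := key2 b hb
    have hl : a.length = b.length := ha'.1.trans hb'.1.symm
    have hp : par a = par b := ha'.2.trans hb'.2.symm
    apply Subtype.ext
    change a = b
    cases a with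
    | nil => cases b with
      | nil => rfl
      | cons => simp at hl
    | cons x a => cases b with
      | nil => simp at hl
      | cons y b =>
        simp only [List.tail_cons] at ht
        subst ht
        simp only [par] at hp
        rw [add_right_cancel hp]
  have := Fintype.card_le_of_injective f hf
  rw [Fintype.card_coe, card_vector, Fintype.card_fin] at this
  exact this.trans (Nat.pow_le_pow_right (by norm_num) (by omega))

theorem stmt16 (k n : ℕ) (hk : 2 ≤ k) (hke : Even k) (hn : k + 1 ≤ n) :
    IsGreatest {m : ℕ | ∃ X : Finset (List (Fin 2)), X.card = m ∧
      (∀ x ∈ X, x.length ≤ n) ∧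
      ∃ w : ZMod X.card → List (Fin 2), GrayCycleList k X w} (2 ^ (n - 1)) := by
  constructor
  · obtain ⟨L, h1, h2, h3⟩ := grayk (k - 1) (n - k - 1)
    rw [show k - 1 + 1 = k by omega, show k - 1 + 2 + (n - k - 1) = n by omega] at h1
    rw [show k - 1 + 1 = k by omega] at h3
    rw [show k - 1 + 1 + (n - k - 1) = n - 1 by omega] at h2
    refine ⟨L.toFinset, ?_, ?_, ?_⟩
    · rw [List.toFinset_card_of_nodup h1.1, h2]
    · intro x hx
      exact (h1.2.1 x (List.mem_toFinset.1 hx)).le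
    · apply exists_cycle k n L h1 ?_ h3
      rintro rfl
      simp at h2
      have := pow_pos (show 0 < 2 by norm_num) (n - 1)
      omega
  · rintro m ⟨X, rfl, hX, w, hw⟩
    exact upper k n hke X hX w hw
end
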